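/- Symbol equivariance of the full iterated SE-RRM recurrence: fix an initial state Z⁰ : Fin D → Fin I → Fin K → ℝ that is constant along the symbol index (Z⁰ d i k = Z⁰ d i k' for all k, k'), and define the recurrence Zstate 0 X = Z⁰ and Zstate (t+1) X = SBlockL (E X + Zstate t X). Then for every t : ℕ, every X : Fin I → Fin K, and every ρ : Equiv.Perm (Fin K), Zstate t (fun i => ρ (X i)) = SymT ρ⁻¹ (Zstate t X). -/

import Mathlib

open Matrix BigOperators

noncomputable def softmax {n : ℕ} (x : Fin n → ℝ) : Fin n → ℝ :=
  fun i => Real.exp (x i) / ∑ j, Real.exp (x j)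

noncomputable def Attn {D n : ℕ} (Wq Wk Wv : Matrix (Fin D) (Fin D) ℝ)
    (H : Matrix (Fin D) (Fin n) ℝ) : Matrix (Fin D) (Fin n) ℝ :=
  fun d j =>
    ∑ i, (softmax (fun i' =>
        dotProduct (Wq.mulVec (fun d => H d j)) (Wk.mulVec (fun d => H d i')))) i *
      (Wv.mulVec (fun d' => H d' i)) d

def PosT {D I K : ℕ} (σ : Equiv.Perm (Fin I)) (Z : Fin D → Fin I → Fin K → ℝ) :
    Fin D → Fin I → Fin K → ℝ :=
  fun d i k => Z d (σ i) k

def SymT {D I K : ℕ} (ρ : Equiv.Perm (Fin K)) (Z : Fin D → Fin I → Fin K → ℝ) :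
    Fin D → Fin I → Fin K → ℝ :=
  fun d i k => Z d i (ρ k)

noncomputable def TI {D I K : ℕ} (Wq Wk Wv : Matrix (Fin D) (Fin D) ℝ)
    (Z : Fin D → Fin I → Fin K → ℝ) : Fin D → Fin I → Fin K → ℝ :=
  fun d i k => (Attn Wq Wk Wv (fun d' i' => Z d' i' k)) d i

noncomputable def TK {D I K : ℕ} (Wq Wk Wv : Matrix (Fin D) (Fin D) ℝ)
    (Z : Fin D → Fin I → Fin K → ℝ) : Fin D → Fin I → Fin K → ℝ :=
  fun d i k => (Attn Wq Wk Wv (fun d' k' => Z d' i k')) d k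

def FiberT {D I K : ℕ} (g : (Fin D → ℝ) → (Fin D → ℝ))
    (Z : Fin D → Fin I → Fin K → ℝ) : Fin D → Fin I → Fin K → ℝ :=
  fun d i k => g (fun d' => Z d' i k) d

noncomputable def SLayer {D I K : ℕ} (Wq Wk Wv Wq' Wk' Wv' : Matrix (Fin D) (Fin D) ℝ)
    (norm m : (Fin D → ℝ) → (Fin D → ℝ))
    (Z : Fin D → Fin I → Fin K → ℝ) : Fin D → Fin I → Fin K → ℝ :=
  let Z' := FiberT norm (Z + TI Wq Wk Wv Z)
  let Z'' := FiberT norm (Z' + TK Wq' Wk' Wv' Z')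
  FiberT norm (Z'' + FiberT m Z'')

noncomputable def SBlock {D I K : ℕ} (Wq Wk Wv Wq' Wk' Wv' : Matrix (Fin D) (Fin D) ℝ)
    (norm m : (Fin D → ℝ) → (Fin D → ℝ)) (L : ℕ) :
    (Fin D → Fin I → Fin K → ℝ) → (Fin D → Fin I → Fin K → ℝ) :=
  (SLayer Wq Wk Wv Wq' Wk' Wv' norm m)^[L]

noncomputable def Emb {D I K : ℕ} (d₀ : Fin D → ℝ) (X : Fin I → Fin K) :
    Fin D → Fin I → Fin K → ℝ :=
  fun a i k => if X i = k then d₀ a else 0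

/-- Iterated SE-RRM recurrence: `Zstate 0 X = Z⁰`, `Zstate (t+1) X = SBlockL (E X + Zstate t X)`. -/
noncomputable def Zstate {D I K : ℕ} (Wq Wk Wv Wq' Wk' Wv' : Matrix (Fin D) (Fin D) ℝ)
    (norm m : (Fin D → ℝ) → (Fin D → ℝ)) (L : ℕ) (d₀ : Fin D → ℝ)
    (Z0 : Fin D → Fin I → Fin K → ℝ) :
    ℕ → (Fin I → Fin K) → (Fin D → Fin I → Fin K → ℝ)
  | 0, _ => Z0
  | t + 1, X =>
      SBlock Wq Wk Wv Wq' Wk' Wv' norm m L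
        (Emb d₀ X + Zstate Wq Wk Wv Wq' Wk' Wv' norm m L d₀ Z0 t X)

theorem softmax_comp_perm {n : ℕ} (ρ : Equiv.Perm (Fin n)) (x : Fin n → ℝ) (i : Fin n) :
    softmax (fun j => x (ρ j)) i = softmax x (ρ i) := by
  simp only [softmax]
  rw [Equiv.sum_comp ρ (fun j => Real.exp (x j))]

theorem Attn_comp_perm {D n : ℕ} (Wq Wk Wv : Matrix (Fin D) (Fin D) ℝ)
    (ρ : Equiv.Perm (Fin n)) (H : Matrix (Fin D) (Fin n) ℝ) (d : Fin D) (j : Fin n) :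
    Attn Wq Wk Wv (fun d' i => H d' (ρ i)) d j = Attn Wq Wk Wv H d (ρ j) := by
  refine Eq.trans (Finset.sum_congr rfl fun i _ => ?_) (Equiv.sum_comp ρ _)
  exact congrArg (· * _) (softmax_comp_perm ρ
    (fun i' => (Wq.mulVec fun d => H d (ρ j)) ⬝ᵥ (Wk.mulVec fun d => H d i')) i)

theorem TK_SymT {D I K : ℕ} (Wq Wk Wv : Matrix (Fin D) (Fin D) ℝ)
    (ρ : Equiv.Perm (Fin K)) (Z : Fin D → Fin I → Fin K → ℝ) :
    TK Wq Wk Wv (SymT ρ Z) = SymT ρ (TK Wq Wk Wv Z) := by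
  funext d i k
  exact Attn_comp_perm Wq Wk Wv ρ (fun d' k' => Z d' i k') d k

theorem TI_SymT {D I K : ℕ} (Wq Wk Wv : Matrix (Fin D) (Fin D) ℝ)
    (ρ : Equiv.Perm (Fin K)) (Z : Fin D → Fin I → Fin K → ℝ) :
    TI Wq Wk Wv (SymT ρ Z) = SymT ρ (TI Wq Wk Wv Z) := rfl

theorem FiberT_SymT {D I K : ℕ} (g : (Fin D → ℝ) → (Fin D → ℝ))
    (ρ : Equiv.Perm (Fin K)) (Z : Fin D → Fin I → Fin K → ℝ) :
    FiberT g (SymT ρ Z) = SymT ρ (FiberT g Z) := rfl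

theorem SymT_add {D I K : ℕ} (ρ : Equiv.Perm (Fin K)) (Y Z : Fin D → Fin I → Fin K → ℝ) :
    SymT ρ (Y + Z) = SymT ρ Y + SymT ρ Z := rfl

theorem SLayer_SymT {D I K : ℕ} (Wq Wk Wv Wq' Wk' Wv' : Matrix (Fin D) (Fin D) ℝ)
    (norm m : (Fin D → ℝ) → (Fin D → ℝ))
    (ρ : Equiv.Perm (Fin K)) (Z : Fin D → Fin I → Fin K → ℝ) :
    SLayer Wq Wk Wv Wq' Wk' Wv' norm m (SymT ρ Z)
      = SymT ρ (SLayer Wq Wk Wv Wq' Wk' Wv' norm m Z) := by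
  simp only [SLayer, TI_SymT, TK_SymT, FiberT_SymT, ← SymT_add]

theorem SBlock_SymT {D I K : ℕ} (Wq Wk Wv Wq' Wk' Wv' : Matrix (Fin D) (Fin D) ℝ)
    (norm m : (Fin D → ℝ) → (Fin D → ℝ)) (L : ℕ)
    (ρ : Equiv.Perm (Fin K)) (Z : Fin D → Fin I → Fin K → ℝ) :
    SBlock Wq Wk Wv Wq' Wk' Wv' norm m L (SymT ρ Z)
      = SymT ρ (SBlock Wq Wk Wv Wq' Wk' Wv' norm m L Z) := by
  have h : Function.Semiconj (SymT ρ) (SLayer Wq Wk Wv Wq' Wk' Wv' norm m)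
      (SLayer (I := I) Wq Wk Wv Wq' Wk' Wv' norm m) :=
    fun Y => (SLayer_SymT Wq Wk Wv Wq' Wk' Wv' norm m ρ Y).symm
  exact (h.iterate_right L Z).symm

theorem Emb_comp_perm {D I K : ℕ} (d₀ : Fin D → ℝ) (X : Fin I → Fin K)
    (ρ : Equiv.Perm (Fin K)) :
    Emb d₀ (fun i => ρ (X i)) = SymT ρ⁻¹ (Emb d₀ X) := by
  funext a i k
  simp only [Emb, SymT, Equiv.Perm.eq_inv_iff_eq]

theorem serrm_recurrence_symbol_equivariant {D I K : ℕ}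
    (Wq Wk Wv Wq' Wk' Wv' : Matrix (Fin D) (Fin D) ℝ)
    (norm m : (Fin D → ℝ) → (Fin D → ℝ)) (L : ℕ) (d₀ : Fin D → ℝ)
    (Z0 : Fin D → Fin I → Fin K → ℝ)
    (hZ0 : ∀ d i k k', Z0 d i k = Z0 d i k') :
    ∀ (t : ℕ) (X : Fin I → Fin K) (ρ : Equiv.Perm (Fin K)),
      Zstate Wq Wk Wv Wq' Wk' Wv' norm m L d₀ Z0 t (fun i => ρ (X i))
        = SymT ρ⁻¹ (Zstate Wq Wk Wv Wq' Wk' Wv' norm m L d₀ Z0 t X) := by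
  intro t X ρ
  induction t with
  | zero =>
    funext d i k
    exact hZ0 d i k (ρ⁻¹ k)
  | succ t ih => rw [Zstate, Zstate, ih, Emb_comp_perm, ← SymT_add, SBlock_SymT]
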